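/- arXiv:1102.2547 — 3 statements merged into one kernel-verified Lean document; each statement's English description precedes it below -/
import Mathlib

section
/- A finite graph Γ admits a totally cyclic orientation if and only if it has no separating edges (i.e. E_sep = ∅). -/
/-!
Serre-style finite graphs: a vertex type `V`, an oriented-edge type `E` with a
fixed-point-free involution `inv` (edge reversal) and source/target maps `s, t`
with `s (inv e) = t e`.  An unoriented edge is an `inv`-orbit `{e, inv e}`;
subsets of unoriented edges are encoded as `inv`-closed subsets of `E`, and an
orientation of a spanning subgraph `Γ∖T` is encoded by the set `O` of its
positively oriented edges.  1-chains with coefficients in `A` are encoded as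
functions `c : E → A` with `c (inv e) = - c e` (so that `(c, e⃗) = c e` for the
standard bilinear form).
-/

structure SerreGraph where
  V : Type
  E : Type
  [fintypeV : Fintype V]
  [fintypeE : Fintype E]
  [decEqV : DecidableEq V]
  [decEqE : DecidableEq E]
  inv : E → E
  s : E → V
  t : E → V
  inv_inv : ∀ e, inv (inv e) = e
  inv_ne : ∀ e, inv e ≠ e
  s_inv : ∀ e, s (inv e) = t e

attribute [instance] SerreGraph.fintypeV SerreGraph.fintypeE
attribute [instance] SerreGraph.decEqV SerreGraph.decEqE

namespace SerreGraph

variable (Γ : SerreGraph)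

/-- Reachability between vertices in the spanning subgraph whose allowed oriented
edges are those in `A`. -/
def Reach (A : Set Γ.E) : Γ.V → Γ.V → Prop :=
  Relation.ReflTransGen (fun a b => ∃ e ∈ A, Γ.s e = a ∧ Γ.t e = b)

/-- The number of connected components of the spanning subgraph with allowed
oriented edges `A`. -/
noncomputable def numComponents (A : Set Γ.E) : ℕ :=
  Nat.card (Quot (fun a b : Γ.V => ∃ e ∈ A, Γ.s e = a ∧ Γ.t e = b))

/-- The set of separating (oriented) edges: removing the underlying unoriented
edge increases the number of connected components. -/
def Esep : Set Γ.E :=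
  {e | Γ.numComponents Set.univ < Γ.numComponents {f | f ≠ e ∧ f ≠ Γ.inv e}}

/-- `T` encodes a set of unoriented edges. -/
def InvClosed (T : Set Γ.E) : Prop := ∀ e, e ∈ T ↔ Γ.inv e ∈ T

/-- `O` is (the set of positively oriented edges of) an orientation of `Γ∖T`. -/
def IsOrientation (T O : Set Γ.E) : Prop :=
  (∀ e ∈ O, e ∉ T) ∧ ∀ e, e ∉ T → (e ∈ O ↔ Γ.inv e ∉ O)

/-- A totally cyclic orientation of `Γ∖T`: an orientation such that there is no
vertex set `W` which is nonempty and proper inside some connected component of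
`Γ∖T` and such that all edges of `Γ∖T` crossing the boundary of `W` are oriented
out of `W` (this is the componentwise condition of the paper). -/
def IsTotallyCyclic (T O : Set Γ.E) : Prop :=
  Γ.IsOrientation T O ∧
    ¬ ∃ W : Set Γ.V, (∃ v ∈ W, ∃ w ∈ Wᶜ, Γ.Reach Tᶜ v w) ∧
        ∀ e ∈ O, Γ.t e ∈ W → Γ.s e ∈ W

/-- `γ` is (the set of positively oriented edges of) an oriented circuit of `Γ`:
a cyclic subgraph (connected, first Betti number one, no separating edges)
together with a totally cyclic orientation; equivalently a directed cycle:
each incident vertex has exactly one outgoing and one incoming edge in `γ`,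
and the support is connected. -/
def IsCircuit (γ : Finset Γ.E) : Prop :=
  γ.Nonempty ∧ (∀ e ∈ γ, Γ.inv e ∉ γ) ∧
    (∀ v ∈ γ.image Γ.s ∪ γ.image Γ.t, ∃! e, e ∈ γ ∧ Γ.s e = v) ∧
    (∀ v ∈ γ.image Γ.s ∪ γ.image Γ.t, ∃! e, e ∈ γ ∧ Γ.t e = v) ∧
    ∀ e ∈ γ, ∀ f ∈ γ, Γ.Reach ((↑γ : Set Γ.E) ∪ Γ.inv '' ↑γ) (Γ.s e) (Γ.s f)

/-- The class `[γ] ∈ H₁(Γ,ℤ)` of an oriented circuit. -/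
def circChainZ (γ : Finset Γ.E) : Γ.E → ℤ :=
  fun e => if e ∈ γ then 1 else if Γ.inv e ∈ γ then -1 else 0

/-- The class `[γ] ∈ H₁(Γ,ℝ)` of an oriented circuit. -/
noncomputable def circChainR (γ : Finset Γ.E) : Γ.E → ℝ :=
  fun e => (Γ.circChainZ γ e : ℝ)

/-- `Cir_φ(Γ∖T)`: oriented circuits of `Γ∖T` compatibly oriented with the
orientation with positive edges `O`. -/
def Cir (T O : Set Γ.E) : Set (Finset Γ.E) :=
  {γ | Γ.IsCircuit γ ∧ (∀ e ∈ γ, e ∈ O) ∧ ∀ e ∈ γ, e ∉ T}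

/-- `c` is a 1-cycle: a skew 1-chain with vanishing boundary, i.e. an element of
`H₁(Γ,A)`. -/
def IsCycle {A : Type*} [AddCommGroup A] (c : Γ.E → A) : Prop :=
  (∀ e, c (Γ.inv e) = - c e) ∧
    ∀ v, ∑ e ∈ Finset.univ.filter (fun e => Γ.t e = v), c e = 0

/-- An element of `H₁(Γ∖T, A) ⊆ H₁(Γ,A)`: a cycle supported on edges not in `T`. -/
def IsCycleOn {A : Type*} [AddCommGroup A] (T : Set Γ.E) (c : Γ.E → A) : Prop :=
  Γ.IsCycle c ∧ ∀ e ∈ T, c e = 0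

/-- The standard positive definite bilinear form on `C⃗₁(Γ,ℝ)`, for which
`(c, e⃗) = c e`. -/
noncomputable def pair (c c' : Γ.E → ℝ) : ℝ := (∑ e, c e * c' e) / 2

/-- The first Betti number `b₁(Γ) = dim_ℝ H₁(Γ,ℝ)`. -/
noncomputable def b1 : ℕ :=
  Module.finrank ℝ (Submodule.span ℝ {c : Γ.E → ℝ | Γ.IsCycle c})

/-- `b₁(Γ∖T) = dim_ℝ H₁(Γ∖T,ℝ)`. -/
noncomputable def b1Sub (T : Set Γ.E) : ℕ :=
  Module.finrank ℝ (Submodule.span ℝ {c : Γ.E → ℝ | Γ.IsCycleOn T c})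

/-- The cone `σ(T,φ) ⊆ H₁(Γ,ℝ)` of the cographic fan associated to a pair
`(T, O)` with `O` an orientation of `Γ∖T`. -/
def sigmaCone (T O : Set Γ.E) : Set (Γ.E → ℝ) :=
  {v | Γ.IsCycle v ∧ (∀ e ∈ O, 0 ≤ v e) ∧ ∀ e ∈ T, v e = 0}

/-- The poset `OP_Γ` of totally cyclic orientations: pairs `(T, O)` with `T` a
set of unoriented edges and `O` a totally cyclic orientation of `Γ∖T`. -/
def OP : Set (Set Γ.E × Set Γ.E) :=
  {p | Γ.InvClosed p.1 ∧ Γ.IsTotallyCyclic p.1 p.2}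

/-- The order on `OP_Γ`: `(T',φ') ≤ (T,φ)` iff `T' ⊇ T` and `φ'` is the
restriction of `φ`. -/
def OPle (p q : Set Γ.E × Set Γ.E) : Prop :=
  q.1 ⊆ p.1 ∧ p.2 = q.2 ∩ p.1ᶜ

/-- `H₁(Γ,ℤ)` viewed as the set of lattice points of `H₁(Γ,ℝ)`. -/
def H1Z : Set (Γ.E → ℝ) := {c | Γ.IsCycle c ∧ ∀ e, ∃ n : ℤ, c e = (n : ℝ)}

/-- The Voronoi polytope `Vor_Γ ⊆ H₁(Γ,ℝ)`. -/
def voronoi : Set (Γ.E → ℝ) :=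
  {v | Γ.IsCycle v ∧ ∀ l ∈ Γ.H1Z, Γ.pair v v ≤ Γ.pair (v - l) (v - l)}

/-- A (exposed) face of the Voronoi polytope. -/
def IsVorFace (F : Set (Γ.E → ℝ)) : Prop :=
  ∃ l : (Γ.E → ℝ) →ₗ[ℝ] ℝ, F = {v | v ∈ Γ.voronoi ∧ ∀ w ∈ Γ.voronoi, l w ≤ l v}

/-- The face `F(T,φ)` of the Voronoi polytope associated to `(T,O) ∈ OP_Γ`. -/
def vorFace (T O : Set Γ.E) : Set (Γ.E → ℝ) :=
  {v | v ∈ Γ.voronoi ∧ ∀ γ ∈ Γ.Cir T O,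
      Γ.pair v (Γ.circChainR γ) = Γ.pair (Γ.circChainR γ) (Γ.circChainR γ) / 2}

end SerreGraph

namespace SerreGraph

variable {Γ : SerreGraph}

theorem t_inv (e : Γ.E) : Γ.t (Γ.inv e) = Γ.s e := by
  rw [← Γ.s_inv, Γ.inv_inv]

theorem Reach.of_edge {A : Set Γ.E} {e : Γ.E} (he : e ∈ A) : Γ.Reach A (Γ.s e) (Γ.t e) :=
  .single ⟨e, he, rfl, rfl⟩

theorem Reach.bind {A B : Set Γ.E} (h : ∀ e ∈ A, Γ.Reach B (Γ.s e) (Γ.t e)) {x y : Γ.V}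
    (hxy : Γ.Reach A x y) : Γ.Reach B x y := by
  induction hxy with
  | refl => exact .refl
  | tail _ hstep ih =>
    obtain ⟨e, he, rfl, rfl⟩ := hstep
    exact ih.trans (h e he)

theorem Reach.bind_rev {A B : Set Γ.E} (h : ∀ e ∈ A, Γ.Reach B (Γ.t e) (Γ.s e)) {x y : Γ.V}
    (hxy : Γ.Reach A x y) : Γ.Reach B y x := by
  induction hxy with
  | refl => exact .refl
  | tail _ hstep ih =>
    obtain ⟨e, he, rfl, rfl⟩ := hstep
    exact (h e he).trans ih

theorem Reach.mem_of_backward_closed {A : Set Γ.E} {W : Set Γ.V}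
    (h : ∀ e ∈ A, Γ.t e ∈ W → Γ.s e ∈ W) {x y : Γ.V} (hxy : Γ.Reach A x y) (hy : y ∈ W) :
    x ∈ W := by
  induction hxy with
  | refl => exact hy
  | tail _ hstep ih =>
    obtain ⟨e, he, rfl, rfl⟩ := hstep
    exact ih (h e he hy)

theorem Reach.mem_of_forward_closed {A : Set Γ.E} {W : Set Γ.V}
    (h : ∀ e ∈ A, Γ.s e ∈ W → Γ.t e ∈ W) {x y : Γ.V} (hxy : Γ.Reach A x y) (hx : x ∈ W) :
    y ∈ W := by
  induction hxy with
  | refl => exact hx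
  | tail _ hstep ih =>
    obtain ⟨e, he, rfl, rfl⟩ := hstep
    exact h e he ih

theorem Reach.symm {A : Set Γ.E} (hA : Γ.InvClosed A) {x y : Γ.V} (h : Γ.Reach A x y) :
    Γ.Reach A y x := by
  refine h.bind_rev fun e he => ?_
  simpa [Γ.s_inv, t_inv] using Reach.of_edge ((hA e).1 he)

/-- The edges other than `e` and its reversal. -/
def edgesAvoiding (e : Γ.E) : Set Γ.E := {f | f ≠ e ∧ f ≠ Γ.inv e}

theorem edgesAvoiding_inv (e : Γ.E) : edgesAvoiding (Γ.inv e) = edgesAvoiding e := by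
  ext f
  simp [edgesAvoiding, Γ.inv_inv, and_comm]

theorem invClosed_edgesAvoiding (e : Γ.E) : Γ.InvClosed (edgesAvoiding e) := by
  intro f
  have h₁ : Γ.inv f = e ↔ f = Γ.inv e :=
    ⟨fun h => by rw [← h, Γ.inv_inv], fun h => by rw [h, Γ.inv_inv]⟩
  have h₂ : Γ.inv f = Γ.inv e ↔ f = e :=
    ⟨fun h => by rw [← Γ.inv_inv f, h, Γ.inv_inv], fun h => by rw [h]⟩
  simp [edgesAvoiding, h₁, h₂, and_comm]

theorem reach_of_quot_mk_eq {A : Set Γ.E} (hA : Γ.InvClosed A) {x y : Γ.V}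
    (h : Quot.mk (fun a b : Γ.V => ∃ e ∈ A, Γ.s e = a ∧ Γ.t e = b) x = Quot.mk _ y) :
    Γ.Reach A x y := by
  replace h := Quot.eqvGen_exact h
  induction h with
  | rel _ _ h => exact .single h
  | refl => exact .refl
  | symm _ _ _ ih => exact ih.symm hA
  | trans _ _ _ _ _ ih₁ ih₂ => exact ih₁.trans ih₂

theorem Reach.quot_mk_eq {A : Set Γ.E} {x y : Γ.V} (h : Γ.Reach A x y) :
    Quot.mk (fun a b : Γ.V => ∃ e ∈ A, Γ.s e = a ∧ Γ.t e = b) x = Quot.mk _ y := by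
  induction h with
  | refl => rfl
  | tail _ hstep ih => exact ih.trans (Quot.sound hstep)

/-- An edge is separating iff its endpoints are disconnected by deleting it. -/
theorem mem_Esep_iff (e : Γ.E) :
    e ∈ Γ.Esep ↔ ¬ Γ.Reach (edgesAvoiding e) (Γ.s e) (Γ.t e) := by
  change Γ.numComponents Set.univ < Γ.numComponents (edgesAvoiding e) ↔ _
  constructor
  · intro hlt hreach
    refine hlt.not_ge ?_
    have hedge (f : Γ.E) : Γ.Reach (edgesAvoiding e) (Γ.s f) (Γ.t f) := by
      by_cases h₁ : f = e
      · rwa [h₁]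
      by_cases h₂ : f = Γ.inv e
      · rw [h₂, Γ.s_inv, t_inv]
        exact hreach.symm (invClosed_edgesAvoiding e)
      exact .of_edge ⟨h₁, h₂⟩
    refine Nat.card_le_card_of_surjective
      (Quot.lift (fun v => Quot.mk _ v) ?_) ?_
    · rintro _ _ ⟨f, -, rfl, rfl⟩
      exact (hedge f).quot_mk_eq
    · rintro ⟨v⟩
      exact ⟨Quot.mk _ v, rfl⟩
  · intro hreach
    let g : Quot (fun a b : Γ.V => ∃ f ∈ edgesAvoiding e, Γ.s f = a ∧ Γ.t f = b) →
        Quot (fun a b : Γ.V => ∃ f ∈ (Set.univ : Set Γ.E), Γ.s f = a ∧ Γ.t f = b) :=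
      Quot.map id fun _ _ ⟨f, _, hf⟩ => ⟨f, trivial, hf⟩
    have hg : Function.Surjective g := by
      rintro ⟨v⟩
      exact ⟨Quot.mk _ v, rfl⟩
    refine lt_of_le_of_ne (Nat.card_le_card_of_surjective g hg) fun hcard => hreach ?_
    have hinj : Function.Injective g :=
      ((Nat.bijective_iff_surjective_and_card g).2 ⟨hg, hcard.symm⟩).1
    exact reach_of_quot_mk_eq (invClosed_edgesAvoiding e)
      (hinj (Quot.sound ⟨e, trivial, rfl, rfl⟩))

theorem IsTotallyCyclic.reach_edgesAvoiding {O : Set Γ.E} (hO : Γ.IsTotallyCyclic ∅ O)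
    {e : Γ.E} (he : e ∈ O) : Γ.Reach (edgesAvoiding e) (Γ.s e) (Γ.t e) := by
  by_contra hreach
  refine hO.2 ⟨{v | Γ.Reach (edgesAvoiding e) (Γ.s e) v},
    ⟨Γ.s e, .refl, Γ.t e, hreach, .of_edge (by simp)⟩, fun f hf hft => ?_⟩
  by_cases h₁ : f = e
  · rw [h₁]
    exact .refl
  have h₂ : f ≠ Γ.inv e := by
    rintro rfl
    exact (hO.1.2 e (by simp)).1 he hf
  exact hft.trans (Reach.symm (invClosed_edgesAvoiding e) (.of_edge ⟨h₁, h₂⟩))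

theorem Reach.avoiding_or_from_endpoint {B : Set Γ.E} (e : Γ.E) {x y : Γ.V}
    (h : Γ.Reach B x y) :
    Γ.Reach (B ∩ edgesAvoiding e) x y ∨ Γ.Reach (B ∩ edgesAvoiding e) (Γ.s e) y ∨
      Γ.Reach (B ∩ edgesAvoiding e) (Γ.t e) y := by
  induction h with
  | refl => exact .inl .refl
  | tail _ hstep ih =>
    obtain ⟨f, hf, rfl, rfl⟩ := hstep
    by_cases h₁ : f = e
    · rw [h₁]
      exact .inr (.inr .refl)
    by_cases h₂ : f = Γ.inv e
    · rw [h₂, t_inv]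
      exact .inr (.inl .refl)
    have hstep := Reach.of_edge (A := B ∩ edgesAvoiding e) ⟨hf, h₁, h₂⟩
    exact ih.imp (·.trans hstep) (.imp (·.trans hstep) (·.trans hstep))

theorem Reach.avoiding_or_to_endpoint {B : Set Γ.E} (e : Γ.E) {x y : Γ.V}
    (h : Γ.Reach B x y) :
    Γ.Reach (B ∩ edgesAvoiding e) x y ∨ Γ.Reach (B ∩ edgesAvoiding e) x (Γ.s e) ∨
      Γ.Reach (B ∩ edgesAvoiding e) x (Γ.t e) := by
  induction h with
  | refl => exact .inl .refl
  | tail _ hstep ih =>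
    obtain ⟨f, hf, rfl, rfl⟩ := hstep
    rcases ih with ih | ih
    · by_cases h₁ : f = e
      · exact .inr (.inl (h₁ ▸ ih))
      by_cases h₂ : f = Γ.inv e
      · rw [h₂, Γ.s_inv] at ih
        exact .inr (.inr ih)
      exact .inl (ih.trans (Reach.of_edge ⟨hf, h₁, h₂⟩))
    · exact .inr ih

/-- `B` contains at least one orientation of each edge, and every edge has its source connected
to its target by a directed path in `B`. -/
def IsStrongMixed (B : Set Γ.E) : Prop :=
  (∀ e, e ∈ B ∨ Γ.inv e ∈ B) ∧ ∀ e, Γ.Reach B (Γ.s e) (Γ.t e)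

theorem IsStrongMixed.diff_singleton {B : Set Γ.E} (hB : IsStrongMixed B) {e : Γ.E}
    (he : Γ.inv e ∈ B) (h : Γ.Reach (B \ {e}) (Γ.s e) (Γ.t e)) : IsStrongMixed (B \ {e}) := by
  refine ⟨fun f => ?_, fun f => (hB.2 f).bind fun g hg => ?_⟩
  · by_cases h₁ : f = e
    · rw [h₁]
      exact .inr ⟨he, Γ.inv_ne e⟩
    by_cases h₂ : Γ.inv f = e
    · refine .inl ⟨?_, h₁⟩
      rwa [← h₂, Γ.inv_inv] at he
    exact (hB.1 f).imp (⟨·, h₁⟩) (⟨·, h₂⟩)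
  · by_cases hge : g = e
    · rwa [hge]
    · exact .of_edge ⟨hg, hge⟩

/-- A non-separating edge of a strongly connected mixed graph still has its endpoints joined, in
one of the two directions, by a directed path avoiding that edge. -/
theorem IsStrongMixed.reach_or_reach {B : Set Γ.E} (hB : IsStrongMixed B) {e : Γ.E}
    (he : Γ.Reach (edgesAvoiding e) (Γ.s e) (Γ.t e)) :
    Γ.Reach (B ∩ edgesAvoiding e) (Γ.s e) (Γ.t e) ∨
      Γ.Reach (B ∩ edgesAvoiding e) (Γ.t e) (Γ.s e) := by
  by_contra! ⟨hst, hts⟩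
  have hconn {x y : Γ.V} (h : Γ.Reach (edgesAvoiding e) x y) : Γ.Reach B x y :=
    h.bind fun f _ => hB.2 f
  have hdisj {x : Γ.V} (hs : Γ.Reach (B ∩ edgesAvoiding e) (Γ.s e) x)
      (ht : Γ.Reach (B ∩ edgesAvoiding e) (Γ.t e) x) : False := by
    have hxs : Γ.Reach B x (Γ.s e) :=
      hconn (Reach.symm (invClosed_edgesAvoiding e)
        (hs.bind fun f hf => .of_edge hf.2))
    rcases hxs.avoiding_or_to_endpoint e with h | h | h
    · exact hts (ht.trans h)
    · exact hts (ht.trans h)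
    · exact hst (hs.trans h)
  refine hst (he.mem_of_forward_closed
    (W := {v | Γ.Reach (B ∩ edgesAvoiding e) (Γ.s e) v}) (fun f hf hfs => ?_) .refl)
  rcases hB.1 f with hfB | hfB
  · exact hfs.trans (Reach.of_edge ⟨hfB, hf⟩)
  have hsf : Γ.Reach B (Γ.s e) (Γ.t f) :=
    (hfs.bind fun g hg => .of_edge hg.1).trans (hB.2 f)
  rcases hsf.avoiding_or_from_endpoint e with h | h | h
  · exact h
  · exact h
  · refine (hdisj hfs (h.trans ?_)).elim
    have hback := Reach.of_edge (A := B ∩ edgesAvoiding e)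
      ⟨hfB, (invClosed_edgesAvoiding e f).1 hf⟩
    rwa [Γ.s_inv, t_inv] at hback

theorem isTotallyCyclic_of_minimal {B : Set Γ.E} (hB : Minimal IsStrongMixed B)
    (h : ∀ e : Γ.E, Γ.Reach (edgesAvoiding e) (Γ.s e) (Γ.t e)) : Γ.IsTotallyCyclic ∅ B := by
  have hmin {e : Γ.E} (he : e ∈ B) (hinv : Γ.inv e ∈ B) :
      ¬ Γ.Reach (B ∩ edgesAvoiding e) (Γ.s e) (Γ.t e) := fun hreach =>
    (hB.2 (hB.1.diff_singleton hinv (hreach.bind fun f hf =>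
      Reach.of_edge (A := B \ {e}) ⟨hf.1, hf.2.1⟩)) Set.sdiff_subset he).2 rfl
  refine ⟨⟨fun _ _ => Set.notMem_empty _, fun e _ => ⟨fun he hinv => ?_,
    (hB.1.1 e).resolve_right⟩⟩, ?_⟩
  · rcases hB.1.reach_or_reach (h e) with hreach | hreach
    · exact hmin he hinv hreach
    · refine hmin hinv (by rwa [Γ.inv_inv]) ?_
      rwa [edgesAvoiding_inv, Γ.s_inv, t_inv]
  · rintro ⟨W, ⟨v, hv, w, hw, hvw⟩, hW⟩
    have hwv : Γ.Reach B w v := hvw.bind_rev fun e _ => by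
      simpa [Γ.s_inv, t_inv] using hB.1.2 (Γ.inv e)
    exact hw (hwv.mem_of_backward_closed hW hv)

end SerreGraph

/-- A finite graph `Γ` admits a totally cyclic orientation if and
only if it has no separating edges. -/
theorem stmt0 (Γ : SerreGraph) :
    (∃ O : Set Γ.E, Γ.IsTotallyCyclic ∅ O) ↔ Γ.Esep = ∅ := by
  rw [Set.eq_empty_iff_forall_notMem]
  simp only [SerreGraph.mem_Esep_iff, not_not]
  constructor
  · rintro ⟨O, hO⟩ e
    by_cases he : e ∈ O
    · exact hO.reach_edgesAvoiding he
    · have hinv : Γ.inv e ∈ O := by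
        by_contra hinv
        exact he ((hO.1.2 e (Set.notMem_empty e)).2 hinv)
      have h := hO.reach_edgesAvoiding hinv
      rw [SerreGraph.edgesAvoiding_inv, Γ.s_inv, SerreGraph.t_inv] at h
      exact h.symm (SerreGraph.invClosed_edgesAvoiding e)
  · intro h
    have huniv : SerreGraph.IsStrongMixed (Set.univ : Set Γ.E) :=
      ⟨fun _ => .inl trivial, fun _ => .of_edge trivial⟩
    obtain ⟨B, hB⟩ := (Set.toFinite {B : Set Γ.E | SerreGraph.IsStrongMixed B}).exists_minimal
      ⟨_, huniv⟩
    exact ⟨B, SerreGraph.isTotallyCyclic_of_minimal hB h⟩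
end

section
/- For elements (T,φ) and (T',φ') of the poset OP_Γ of totally cyclic orientations, one has (T',φ') ≤ (T,φ) if and only if Cir_{φ'}(Γ∖T') ⊆ Cir_φ(Γ∖T). -/
namespace SerreGraph

/-- The edges `g 0, …, g n` belong to `O` and form a directed walk. -/
def IsDirWalk (Γ : SerreGraph) (O : Set Γ.E) (n : ℕ) (g : ℕ → Γ.E) : Prop :=
  (∀ i ≤ n, g i ∈ O) ∧ ∀ i < n, Γ.t (g i) = Γ.s (g (i + 1))

theorem Reach.exists_isDirWalk {Γ : SerreGraph} {O : Set Γ.E} {e : Γ.E} (he : e ∈ O) {v : Γ.V}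
    (h : Γ.Reach O (Γ.t e) v) :
    ∃ n g, Γ.IsDirWalk O n g ∧ g 0 = e ∧ Γ.t (g n) = v := by
  induction h with
  | refl => exact ⟨0, fun _ => e, ⟨fun _ _ => he, fun _ h => absurd h (Nat.not_lt_zero _)⟩, rfl, rfl⟩
  | tail _ hbc ih =>
    obtain ⟨n, g, ⟨hO, hg⟩, h0, hn⟩ := ih
    obtain ⟨f, hf, hs, ht⟩ := hbc
    refine ⟨n + 1, fun k => if k ≤ n then g k else f, ⟨fun i _ => ?_, fun i hi => ?_⟩, ?_, ?_⟩
    · dsimp only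
      split_ifs with h
      · exact hO i h
      · exact hf
    · rcases Nat.lt_or_ge i n with h | h
      · simp [h.le, Nat.succ_le_of_lt h, hg i h]
      · obtain rfl : i = n := by omega
        simp [hn, hs]
    · simpa using h0
    · simpa using ht

/-- A directed closed walk can be shortened to one with pairwise distinct vertices
starting with the same edge. -/
theorem IsDirWalk.exists_injOn {Γ : SerreGraph} {O : Set Γ.E} {n : ℕ} {g : ℕ → Γ.E}
    (hg : Γ.IsDirWalk O n g) (hclosed : Γ.t (g n) = Γ.s (g 0)) :
    ∃ m g', Γ.IsDirWalk O m g' ∧ g' 0 = g 0 ∧ Γ.t (g' m) = Γ.s (g' 0) ∧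
      Set.InjOn (fun i => Γ.s (g' i)) (Set.Iic m) := by
  induction n using Nat.strong_induction_on generalizing g with
  | _ n ih =>
  by_cases hinj : Set.InjOn (fun i => Γ.s (g i)) (Set.Iic n)
  · exact ⟨n, g, hg, rfl, hclosed, hinj⟩
  obtain ⟨i, j, hij, hj, hs⟩ : ∃ i j, i < j ∧ j ≤ n ∧ Γ.s (g i) = Γ.s (g j) := by
    simp only [Set.InjOn, Set.mem_Iic, not_forall] at hinj
    obtain ⟨i, hi, j, hj, hs, hne⟩ := hinj
    rcases Nat.lt_or_gt_of_ne hne with h | h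
    · exact ⟨i, j, h, hj, hs⟩
    · exact ⟨j, i, h, hi, hs.symm⟩
  obtain ⟨hO, hg⟩ := hg
  rcases Nat.eq_zero_or_pos i with rfl | hi
  · refine ih (j - 1) (by omega) ⟨fun k hk => hO k (by omega), fun k hk => hg k (by omega)⟩ ?_
    rw [hg (j - 1) (by omega), Nat.sub_add_cancel hij, hs]
  · have h := ih (n - (j - i)) (by omega)
      (g := fun k => if k < i then g k else g (k + (j - i))) ⟨fun k hk => ?_, fun k hk => ?_⟩ ?_
    · simpa only [hi, if_true] using h
    · dsimp only
      split_ifs <;> exact hO _ (by omega)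
    · dsimp only
      rcases Nat.lt_trichotomy (k + 1) i with h | h | h
      · rw [if_pos (by omega), if_pos h, hg k (by omega)]
      · rw [if_pos (by omega), if_neg (by omega), hg k (by omega), h, hs]
        congr 2
        omega
      · rw [if_neg (by omega), if_neg (by omega), hg _ (by omega)]
        congr 2
        omega
    · rw [if_pos hi, if_neg (by omega), ← hclosed]
      congr 2
      omega

/-- A directed closed walk with pairwise distinct vertices, none of whose edges is traversed
in both directions, is an oriented circuit. -/
theorem IsDirWalk.isCircuit {Γ : SerreGraph} {O : Set Γ.E} (hO : ∀ e ∈ O, Γ.inv e ∉ O)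
    {n : ℕ} {g : ℕ → Γ.E} (hg : Γ.IsDirWalk O n g) (hclosed : Γ.t (g n) = Γ.s (g 0))
    (hinj : Set.InjOn (fun i => Γ.s (g i)) (Set.Iic n)) :
    Γ.IsCircuit ((Finset.range (n + 1)).image g) := by
  have hmem : ∀ e, e ∈ (Finset.range (n + 1)).image g ↔ ∃ i ≤ n, g i = e := by
    simp
  have hgm : ∀ i ≤ n, g i ∈ (Finset.range (n + 1)).image g := fun i hi => (hmem _).2 ⟨i, hi, rfl⟩
  have hnext : ∀ i ≤ n, ∃ j ≤ n, Γ.s (g j) = Γ.t (g i) ∧ (i < n ∧ j = i + 1 ∨ i = n ∧ j = 0) := by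
    intro i hi
    rcases Nat.lt_or_ge i n with h | h
    · exact ⟨i + 1, h, (hg.2 i h).symm, .inl ⟨h, rfl⟩⟩
    · obtain rfl : i = n := by omega
      exact ⟨0, by omega, hclosed.symm, .inr ⟨rfl, rfl⟩⟩
  have hprev : ∀ i ≤ n, ∃ j ≤ n, Γ.t (g j) = Γ.s (g i) := by
    intro i hi
    rcases Nat.eq_zero_or_pos i with rfl | h
    · exact ⟨n, le_rfl, hclosed⟩
    · refine ⟨i - 1, by omega, ?_⟩
      rw [hg.2 (i - 1) (by omega), Nat.sub_add_cancel h]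
  have htinj : ∀ i ≤ n, ∀ j ≤ n, Γ.t (g i) = Γ.t (g j) → i = j := by
    intro i hi j hj h
    obtain ⟨i', hi', hsi, hi''⟩ := hnext i hi
    obtain ⟨j', hj', hsj, hj''⟩ := hnext j hj
    have : i' = j' := hinj hi' hj' (hsi.trans (h.trans hsj.symm))
    omega
  have hvert : ∀ v ∈ ((Finset.range (n + 1)).image g).image Γ.s ∪
      ((Finset.range (n + 1)).image g).image Γ.t, ∃ i ≤ n, Γ.s (g i) = v := by
    intro v hv
    rcases Finset.mem_union.1 hv with hv | hv
    · obtain ⟨e, he, rfl⟩ := Finset.mem_image.1 hv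
      obtain ⟨i, hi, rfl⟩ := (hmem e).1 he
      exact ⟨i, hi, rfl⟩
    · obtain ⟨e, he, rfl⟩ := Finset.mem_image.1 hv
      obtain ⟨i, hi, rfl⟩ := (hmem e).1 he
      obtain ⟨j, hj, hs, -⟩ := hnext i hi
      exact ⟨j, hj, hs⟩
  refine ⟨⟨g 0, hgm 0 (Nat.zero_le n)⟩, fun e he he' => ?_, fun v hv => ?_, fun v hv => ?_,
    fun e he f hf => ?_⟩
  · obtain ⟨i, hi, rfl⟩ := (hmem e).1 he
    obtain ⟨j, hj, h⟩ := (hmem _).1 he'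
    exact hO _ (hg.1 i hi) (h ▸ hg.1 j hj)
  · obtain ⟨i, hi, rfl⟩ := hvert v hv
    refine ⟨g i, ⟨hgm i hi, rfl⟩, ?_⟩
    rintro e ⟨he, hs⟩
    obtain ⟨j, hj, rfl⟩ := (hmem e).1 he
    rw [hinj hj hi hs]
  · obtain ⟨i, hi, rfl⟩ := hvert v hv
    obtain ⟨k, hk, hks⟩ := hprev i hi
    refine ⟨g k, ⟨hgm k hk, hks⟩, ?_⟩
    rintro e ⟨he, ht⟩
    obtain ⟨j, hj, rfl⟩ := (hmem e).1 he
    rw [htinj j hj k hk (ht.trans hks.symm)]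
  · obtain ⟨i, hi, rfl⟩ := (hmem e).1 he
    obtain ⟨j, hj, rfl⟩ := (hmem f).1 hf
    set A : Set Γ.E := (↑((Finset.range (n + 1)).image g) : Set Γ.E) ∪
      Γ.inv '' ↑((Finset.range (n + 1)).image g) with hA
    have hfwd : ∀ k ≤ n, Γ.Reach A (Γ.s (g 0)) (Γ.s (g k)) := by
      intro k
      induction k with
      | zero => exact fun _ => .refl
      | succ k ih =>
        exact fun hk => (ih (by omega)).tail
          ⟨g k, .inl (Finset.mem_coe.2 (hgm k (by omega))), rfl, hg.2 k hk⟩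
    have hlast : Γ.Reach A (Γ.s (g n)) (Γ.s (g 0)) :=
      .single ⟨g n, .inl (Finset.mem_coe.2 (hgm n le_rfl)), rfl, hclosed⟩
    have hback : ∀ k ≤ n, Γ.Reach A (Γ.s (g k)) (Γ.s (g n)) := by
      intro k hk
      induction hk using Nat.decreasingInduction with
      | self => exact .refl
      | of_succ k hk ih =>
        exact .head ⟨g k, .inl (Finset.mem_coe.2 (hgm k hk.le)), rfl, hg.2 k hk⟩ ih
    exact ((hback i hi).trans hlast).trans (hfwd j hj)

theorem IsTotallyCyclic.reach {Γ : SerreGraph} {T O : Set Γ.E} (h : Γ.IsTotallyCyclic T O)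
    {e : Γ.E} (he : e ∈ O) : Γ.Reach O (Γ.t e) (Γ.s e) := by
  by_contra hne
  exact h.2 ⟨{v | Γ.Reach O v (Γ.s e)},
    ⟨Γ.s e, .refl, Γ.t e, hne, .single ⟨e, h.1.1 e he, rfl, rfl⟩⟩,
    fun f hf hft => .head ⟨f, hf, rfl, rfl⟩ hft⟩

theorem IsTotallyCyclic.exists_mem_cir {Γ : SerreGraph} {T O : Set Γ.E}
    (h : Γ.IsTotallyCyclic T O) {e : Γ.E} (he : e ∈ O) : ∃ γ ∈ Γ.Cir T O, e ∈ γ := by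
  obtain ⟨n, g, hg, rfl, hn⟩ := (h.reach he).exists_isDirWalk he
  obtain ⟨m, g', hg', h0, hclosed, hinj⟩ := hg.exists_injOn hn
  have hsub : ∀ f ∈ (Finset.range (m + 1)).image g', f ∈ O := by
    intro f hf
    obtain ⟨i, hi, rfl⟩ := Finset.mem_image.1 hf
    exact hg'.1 i (Nat.lt_succ_iff.1 (Finset.mem_range.1 hi))
  refine ⟨(Finset.range (m + 1)).image g', ⟨?_, hsub, fun f hf => h.1.1 f (hsub f hf)⟩, ?_⟩
  · exact hg'.isCircuit (fun f hf => (h.1.2 f (h.1.1 f hf)).1 hf) hclosed hinj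
  · exact Finset.mem_image.2 ⟨0, Finset.mem_range.2 m.succ_pos, h0⟩

end SerreGraph

/-- For `(T,φ), (T',φ') ∈ OP_Γ`: `(T',φ') ≤ (T,φ)` iff
`Cir_{φ'}(Γ∖T') ⊆ Cir_φ(Γ∖T)`. -/
theorem stmt3 (Γ : SerreGraph) (p q : Set Γ.E × Set Γ.E)
    (hp : p ∈ Γ.OP) (hq : q ∈ Γ.OP) :
    Γ.OPle p q ↔ Γ.Cir p.1 p.2 ⊆ Γ.Cir q.1 q.2 := by
  obtain ⟨-, hpc⟩ := hp
  obtain ⟨hqi, hqc⟩ := hq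
  constructor
  · rintro ⟨hT, hO⟩ γ ⟨hγ, hγO, hγT⟩
    exact ⟨hγ, fun e he => (hO ▸ hγO e he : e ∈ q.2 ∩ p.1ᶜ).1, fun e he h => hγT e he (hT h)⟩
  · intro h
    have hsub : ∀ e ∈ p.2, e ∈ q.2 := by
      intro e he
      obtain ⟨γ, hγ, heγ⟩ := hpc.exists_mem_cir he
      exact (h hγ).2.1 e heγ
    have hinv : ∀ e ∉ p.1, e ∉ p.2 → Γ.inv e ∈ q.2 := fun e he he' =>
      hsub _ (not_not.1 fun hn => he' ((hpc.1.2 e he).2 hn))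
    refine ⟨fun e he => ?_, Set.Subset.antisymm (fun e he => ⟨hsub e he, hpc.1.1 e he⟩) ?_⟩
    · by_contra hep
      by_cases heO : e ∈ p.2
      · exact hqc.1.1 e (hsub e heO) he
      · exact hqc.1.1 _ (hinv e hep heO) ((hqi e).1 he)
    · rintro e ⟨he, hep⟩
      by_contra heO
      exact (hqc.1.2 e (hqc.1.1 e he)).1 he (hinv e hep heO)
end

section
/- For every (T,φ) ∈ OP_Γ, the extremal rays of the cone σ(T,φ) are exactly the rays ℝ≥0·[γ] for γ ∈ Cir_φ(Γ∖T). -/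
namespace SerreGraph

variable {Γ : SerreGraph}

theorem circChainR_of_mem {γ : Finset Γ.E} {e : Γ.E} (he : e ∈ γ) :
    Γ.circChainR γ e = 1 := by
  simp [circChainR, circChainZ, he]

theorem circChainR_of_inv_mem {γ : Finset Γ.E} {e : Γ.E} (he : e ∉ γ) (he' : Γ.inv e ∈ γ) :
    Γ.circChainR γ e = -1 := by
  simp [circChainR, circChainZ, he, he']

theorem circChainR_of_not_mem {γ : Finset Γ.E} {e : Γ.E} (he : e ∉ γ) (he' : Γ.inv e ∉ γ) :
    Γ.circChainR γ e = 0 := by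
  simp [circChainR, circChainZ, he, he']

theorem circChainR_inv {γ : Finset Γ.E} (hγ : Γ.IsCircuit γ) (e : Γ.E) :
    Γ.circChainR γ (Γ.inv e) = -Γ.circChainR γ e := by
  by_cases h : e ∈ γ
  · rw [circChainR_of_mem h,
      circChainR_of_inv_mem (hγ.2.1 e h) (by rwa [Γ.inv_inv])]
  · by_cases h' : Γ.inv e ∈ γ
    · rw [circChainR_of_mem h', circChainR_of_inv_mem h h', neg_neg]
    · rw [circChainR_of_not_mem h h',
        circChainR_of_not_mem h' (by rwa [Γ.inv_inv]), neg_zero]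

/-- The boundary at `v` of a chain supported on a circuit is the difference of its values on
the incoming and the outgoing edge at `v`. -/
theorem IsCircuit.sum_target_eq {γ : Finset Γ.E} (hγ : Γ.IsCircuit γ) {y : Γ.E → ℝ}
    (hy : ∀ e, y (Γ.inv e) = -y e) (hsupp : ∀ e, e ∉ γ → Γ.inv e ∉ γ → y e = 0)
    {e f : Γ.E} (he : e ∈ γ) (hf : f ∈ γ) (h : Γ.t e = Γ.s f) :
    ∑ a ∈ Finset.univ.filter (fun a => Γ.t a = Γ.s f), y a = y e - y f := by
  have hv : Γ.s f ∈ γ.image Γ.s ∪ γ.image Γ.t :=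
    Finset.mem_union_left _ (Finset.mem_image_of_mem _ hf)
  have hne : e ≠ Γ.inv f := fun h' => hγ.2.1 f hf (h' ▸ he)
  rw [sub_eq_add_neg, ← hy f, ← Finset.sum_pair hne]
  symm
  apply Finset.sum_subset
  · intro a ha
    rcases Finset.mem_insert.1 ha with rfl | ha
    · simpa using h
    · rw [Finset.mem_singleton.1 ha]
      simp [t_inv]
  · intro a ha hna
    have hta : Γ.t a = Γ.s f := by simpa using ha
    apply hsupp a
    · intro haγ
      exact hna (by simp [(hγ.2.2.2.1 _ hv).unique ⟨haγ, hta⟩ ⟨he, h⟩])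
    · intro haγ
      have := (hγ.2.2.1 _ hv).unique ⟨haγ, (Γ.s_inv a).trans hta⟩ ⟨hf, rfl⟩
      exact hna (by simp [← this, Γ.inv_inv])

theorem IsCircuit.isCycle_circChainR {γ : Finset Γ.E} (hγ : Γ.IsCircuit γ) :
    Γ.IsCycle (Γ.circChainR γ) := by
  refine ⟨circChainR_inv hγ, fun v => ?_⟩
  by_cases hv : v ∈ γ.image Γ.s ∪ γ.image Γ.t
  · obtain ⟨f, ⟨hf, rfl⟩, -⟩ := hγ.2.2.1 v hv
    obtain ⟨e, ⟨he, het⟩, -⟩ := hγ.2.2.2.1 _ hv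
    rw [hγ.sum_target_eq (circChainR_inv hγ) (fun _ => circChainR_of_not_mem) he hf het,
      circChainR_of_mem he, circChainR_of_mem hf, sub_self]
  · refine Finset.sum_eq_zero fun a ha => ?_
    have hta : Γ.t a = v := by simpa using ha
    refine circChainR_of_not_mem (fun h => hv ?_) (fun h => hv ?_)
    · exact Finset.mem_union_right _ (Finset.mem_image.2 ⟨a, h, hta⟩)
    · exact Finset.mem_union_left _ (Finset.mem_image.2 ⟨_, h, (Γ.s_inv a).trans hta⟩)

/-- A cycle supported on a circuit is constant along the circuit. -/
theorem IsCircuit.apply_eq_apply {γ : Finset Γ.E} (hγ : Γ.IsCircuit γ) {y : Γ.E → ℝ}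
    (hy : Γ.IsCycle y) (hsupp : ∀ e, e ∉ γ → Γ.inv e ∉ γ → y e = 0)
    {e f : Γ.E} (he : e ∈ γ) (hf : f ∈ γ) : y e = y f := by
  have step : ∀ a ∈ γ, ∀ b ∈ γ, Γ.t a = Γ.s b → y a = y b := fun a ha b hb hab =>
    sub_eq_zero.1 ((hγ.sum_target_eq hy.1 hsupp ha hb hab).symm.trans (hy.2 _))
  have key : ∀ w, Γ.Reach ((↑γ : Set Γ.E) ∪ Γ.inv '' ↑γ) (Γ.s e) w →
      ∃ b ∈ γ, Γ.s b = w ∧ y e = y b := by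
    intro w hw
    induction hw with
    | refl => exact ⟨e, he, rfl, rfl⟩
    | tail _ hstep ih =>
      obtain ⟨b, hb, hbw, hyb⟩ := ih
      obtain ⟨c, hc, hcs, rfl⟩ := hstep
      rcases hc with hc | ⟨d, hd, rfl⟩
      · have hc : c ∈ γ := hc
        obtain ⟨g, ⟨hg, hgs⟩, -⟩ := hγ.2.2.1 (Γ.t c)
          (Finset.mem_union_right _ (Finset.mem_image_of_mem _ hc))
        have hcb : c = b := (hγ.2.2.1 (Γ.s b)
          (Finset.mem_union_left _ (Finset.mem_image_of_mem _ hb))).unique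
          ⟨hc, hcs.trans hbw.symm⟩ ⟨hb, rfl⟩
        exact ⟨g, hg, hgs, hyb.trans (hcb ▸ step c hc g hg hgs.symm)⟩
      · have hd : d ∈ γ := hd
        refine ⟨d, hd, (t_inv d).symm, hyb.trans (step d hd b hb ?_).symm⟩
        rw [hbw, ← hcs, Γ.s_inv]
  obtain ⟨b, hb, hbf, hyb⟩ := key _ (hγ.2.2.2.2 e he f hf)
  rw [hyb, (hγ.2.2.1 (Γ.s f) (Finset.mem_union_left _
    (Finset.mem_image_of_mem _ hf))).unique ⟨hb, hbf⟩ ⟨hf, rfl⟩]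

theorem IsCircuit.eq_smul_circChainR {γ : Finset Γ.E} (hγ : Γ.IsCircuit γ) {y : Γ.E → ℝ}
    (hy : Γ.IsCycle y) (hsupp : ∀ e, e ∉ γ → Γ.inv e ∉ γ → y e = 0)
    {e : Γ.E} (he : e ∈ γ) : y = y e • Γ.circChainR γ := by
  funext a
  rw [Pi.smul_apply, smul_eq_mul]
  by_cases h : a ∈ γ
  · rw [circChainR_of_mem h, mul_one, hγ.apply_eq_apply hy hsupp h he]
  · by_cases h' : Γ.inv a ∈ γ
    · rw [circChainR_of_inv_mem h h', ← hγ.apply_eq_apply hy hsupp h' he, hy.1]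
      ring
    · rw [circChainR_of_not_mem h h', mul_zero, hsupp a h h']

/-- A set of oriented edges which is antisymmetric and in which every edge can be continued
contains an oriented circuit. -/
theorem exists_isCircuit {P : Set Γ.E} {e₀ : Γ.E} (he₀ : e₀ ∈ P)
    (hanti : ∀ e ∈ P, Γ.inv e ∉ P) (hnext : ∀ e ∈ P, ∃ f ∈ P, Γ.s f = Γ.t e) :
    ∃ γ : Finset Γ.E, Γ.IsCircuit γ ∧ ∀ e ∈ γ, e ∈ P := by
  classical
  have : Nonempty Γ.E := ⟨e₀⟩
  have hchoice : ∀ v, (∃ e ∈ P, Γ.s e = v) → ∃ e, e ∈ P ∧ Γ.s e = v :=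
    fun v ⟨e, h, h'⟩ => ⟨e, h, h'⟩
  choose! nxt hnxtP hnxts using hchoice
  set F : Γ.V → Γ.V := fun v => Γ.t (nxt v) with hF
  have hgood : ∀ n, ∃ e ∈ P, Γ.s e = F^[n] (Γ.s e₀) := by
    intro n
    induction n with
    | zero => exact ⟨e₀, he₀, rfl⟩
    | succ n ih =>
      rw [Function.iterate_succ_apply']
      exact hnext _ (hnxtP _ ih)
  obtain ⟨i, k, hk, hper⟩ : ∃ i k, 0 < k ∧ F^[k] (F^[i] (Γ.s e₀)) = F^[i] (Γ.s e₀) := by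
    obtain ⟨a, b, hab, heq⟩ :=
      Finite.exists_ne_map_eq_of_infinite (fun n => F^[n] (Γ.s e₀))
    rcases lt_or_gt_of_ne hab with h | h
    · refine ⟨a, b - a, by omega, ?_⟩
      rw [← Function.iterate_add_apply, Nat.sub_add_cancel h.le]
      exact heq.symm
    · refine ⟨b, a - b, by omega, ?_⟩
      rw [← Function.iterate_add_apply, Nat.sub_add_cancel h.le]
      exact heq
  set v₀ := F^[i] (Γ.s e₀) with hv₀
  have hgood' : ∀ n, ∃ e ∈ P, Γ.s e = F^[n] v₀ := fun n => by
    rw [hv₀, ← Function.iterate_add_apply]; exact hgood _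
  have hper' : ∀ n, F^[n * k] v₀ = v₀ := fun n =>
    (Function.IsPeriodicPt.const_mul (f := F) hper n)
  have hsucc : ∀ n, Γ.t (nxt (F^[n] v₀)) = F^[n + 1] v₀ := fun n => by
    rw [Function.iterate_succ_apply']
  have hperv : ∀ n, F^[k] (F^[n] v₀) = F^[n] v₀ := fun n => by
    rw [← Function.iterate_add_apply, add_comm, Function.iterate_add_apply, hper]
  have hinj : ∀ m n, F^[m + 1] v₀ = F^[n + 1] v₀ → F^[m] v₀ = F^[n] v₀ := fun m n h => by
    obtain ⟨j, rfl⟩ : ∃ j, k = j + 1 := ⟨k - 1, by omega⟩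
    rw [Function.iterate_succ_apply', Function.iterate_succ_apply'] at h
    rw [← hperv m, ← hperv n, Function.iterate_succ_apply, Function.iterate_succ_apply, h]
  set γ : Finset Γ.E := Finset.univ.filter (fun e => ∃ n, nxt (F^[n] v₀) = e) with hγ
  have hmem : ∀ e, e ∈ γ ↔ ∃ n, nxt (F^[n] v₀) = e := fun e => by simp [hγ]
  have hγP : ∀ e ∈ γ, e ∈ P := fun e he => by
    obtain ⟨n, rfl⟩ := (hmem e).1 he
    exact hnxtP _ (hgood' n)
  have hvert : ∀ v ∈ γ.image Γ.s ∪ γ.image Γ.t, ∃ n, v = F^[n + 1] v₀ := by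
    intro v hv
    rcases Finset.mem_union.1 hv with hv | hv
    · obtain ⟨e, he, rfl⟩ := Finset.mem_image.1 hv
      obtain ⟨n, rfl⟩ := (hmem e).1 he
      refine ⟨n + (k - 1), ?_⟩
      rw [hnxts _ (hgood' n), show n + (k - 1) + 1 = k + n by omega,
        Function.iterate_add_apply, hperv]
    · obtain ⟨e, he, rfl⟩ := Finset.mem_image.1 hv
      obtain ⟨n, rfl⟩ := (hmem e).1 he
      exact ⟨n, hsucc n⟩
  have hreach : ∀ n m, Γ.Reach ((↑γ : Set Γ.E) ∪ Γ.inv '' ↑γ) (F^[n] v₀) (F^[n + m] v₀) := by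
    intro n m
    induction m with
    | zero => exact Relation.ReflTransGen.refl
    | succ m ih =>
      exact ih.tail ⟨nxt (F^[n + m] v₀), Or.inl ((hmem _).2 ⟨_, rfl⟩),
        hnxts _ (hgood' _), hsucc _⟩
  refine ⟨γ, ⟨⟨nxt v₀, (hmem _).2 ⟨0, rfl⟩⟩, fun e he he' => hanti e (hγP e he) (hγP _ he'),
    ?_, ?_, ?_⟩, hγP⟩
  · intro v hv
    obtain ⟨n, rfl⟩ := hvert v hv
    refine ⟨nxt (F^[n + 1] v₀), ⟨(hmem _).2 ⟨_, rfl⟩, hnxts _ (hgood' _)⟩, ?_⟩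
    rintro e ⟨he, hes⟩
    obtain ⟨m, rfl⟩ := (hmem e).1 he
    rw [hnxts _ (hgood' m)] at hes
    rw [hes]
  · intro v hv
    obtain ⟨n, rfl⟩ := hvert v hv
    refine ⟨nxt (F^[n] v₀), ⟨(hmem _).2 ⟨_, rfl⟩, hsucc n⟩, ?_⟩
    rintro e ⟨he, het⟩
    obtain ⟨m, rfl⟩ := (hmem e).1 he
    rw [hsucc] at het
    rw [hinj m n het]
  · intro e he f hf
    obtain ⟨n, rfl⟩ := (hmem e).1 he
    obtain ⟨m, rfl⟩ := (hmem f).1 hf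
    rw [hnxts _ (hgood' n), hnxts _ (hgood' m)]
    have h₁ := hreach n (n * k - n)
    rw [Nat.add_sub_cancel' (Nat.le_mul_of_pos_right n hk), hper'] at h₁
    have h₂ := hreach 0 m
    rw [zero_add] at h₂
    exact h₁.trans h₂

/-- A positive edge of a cycle is followed by a positive edge. -/
theorem IsCycle.exists_pos_next {x : Γ.E → ℝ} (hx : Γ.IsCycle x) {e : Γ.E} (he : 0 < x e) :
    ∃ f, 0 < x f ∧ Γ.s f = Γ.t e := by
  by_contra! h
  have hnn : ∀ a ∈ Finset.univ.filter (fun a => Γ.t a = Γ.t e), 0 ≤ x a := by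
    intro a ha
    by_contra! hneg
    exact h (Γ.inv a) (by rw [hx.1]; linarith) ((Γ.s_inv a).trans (by simpa using ha))
  have := Finset.single_le_sum hnn (show e ∈ _ by simp)
  rw [hx.2] at this
  linarith

/-- Every nonzero cycle contains an oriented circuit on whose edges it is positive. -/
theorem IsCycle.exists_isCircuit_pos {x : Γ.E → ℝ} (hx : Γ.IsCycle x) (hx0 : x ≠ 0) :
    ∃ γ : Finset Γ.E, Γ.IsCircuit γ ∧ ∀ e ∈ γ, 0 < x e := by
  obtain ⟨e₀, he₀⟩ : ∃ e, 0 < x e := by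
    obtain ⟨e, he⟩ := Function.ne_iff.1 hx0
    rcases lt_or_gt_of_ne he with h | h
    · exact ⟨Γ.inv e, by rw [hx.1]; exact neg_pos.2 h⟩
    · exact ⟨e, h⟩
  refine exists_isCircuit (P := {e | 0 < x e}) he₀ (fun e he he' => ?_)
    fun e he => hx.exists_pos_next he
  simp only [Set.mem_ofPred_eq, hx.1] at he he'
  linarith

theorem IsCycle.sub_smul {x y : Γ.E → ℝ} (hx : Γ.IsCycle x) (hy : Γ.IsCycle y) (m : ℝ) :
    Γ.IsCycle (x - m • y) := by
  refine ⟨fun e => ?_, fun v => ?_⟩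
  · simp only [Pi.sub_apply, Pi.smul_apply, smul_eq_mul, hx.1, hy.1]
    ring
  · simp only [Pi.sub_apply, Pi.smul_apply, smul_eq_mul, Finset.sum_sub_distrib,
      ← Finset.mul_sum, hx.2, hy.2, mul_zero, sub_zero]

theorem IsCycle.smul {y : Γ.E → ℝ} (hy : Γ.IsCycle y) (m : ℝ) : Γ.IsCycle (m • y) := by
  refine ⟨fun e => ?_, fun v => ?_⟩
  · simp only [Pi.smul_apply, smul_eq_mul, hy.1, mul_neg]
  · simp only [Pi.smul_apply, smul_eq_mul, ← Finset.mul_sum, hy.2, mul_zero]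

section Orientation

variable {T O : Set Γ.E}

theorem IsOrientation.inv_notMem (hO : Γ.IsOrientation T O) {e : Γ.E} (he : e ∈ O) :
    Γ.inv e ∉ O :=
  (hO.2 e (hO.1 e he)).1 he

theorem IsOrientation.mem_of_pos (hO : Γ.IsOrientation T O) {x : Γ.E → ℝ}
    (hx : x ∈ Γ.sigmaCone T O) {e : Γ.E} (he : 0 < x e) : e ∈ O := by
  have heT : e ∉ T := fun h => he.ne' (hx.2.2 e h)
  refine (hO.2 e heT).2 fun h => ?_
  have := hx.2.1 _ h
  rw [hx.1.1] at this
  linarith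

theorem circChainR_nonneg (hO : Γ.IsOrientation T O) {γ : Finset Γ.E} (hγ : γ ∈ Γ.Cir T O)
    {e : Γ.E} (he : e ∈ O) : 0 ≤ Γ.circChainR γ e := by
  by_cases h : e ∈ γ
  · rw [circChainR_of_mem h]
    exact zero_le_one
  · rw [circChainR_of_not_mem h fun h' => hO.inv_notMem he (hγ.2.1 _ h')]

theorem circChainR_eq_zero_of_mem (hT : Γ.InvClosed T) {γ : Finset Γ.E}
    (hγ : γ ∈ Γ.Cir T O) {e : Γ.E} (he : e ∈ T) : Γ.circChainR γ e = 0 :=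
  circChainR_of_not_mem (fun h => hγ.2.2 e h he) fun h => hγ.2.2 _ h ((hT e).1 he)

/-- A cycle of the cone dominated by a multiple of the class of a circuit is supported on that
circuit. -/
theorem eq_zero_of_add_eq (hO : Γ.IsOrientation T O)
    {y z : Γ.E → ℝ} (hy : y ∈ Γ.sigmaCone T O) (hz : z ∈ Γ.sigmaCone T O) {γ : Finset Γ.E}
    {r : ℝ} (h : r • Γ.circChainR γ = y + z) {e : Γ.E} (he : e ∉ γ) (he' : Γ.inv e ∉ γ) :
    y e = 0 := by
  have main : ∀ a ∈ O, a ∉ γ → Γ.inv a ∉ γ → y a = 0 := by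
    intro a ha h₁ h₂
    have hsum := congrFun h a
    rw [Pi.smul_apply, circChainR_of_not_mem h₁ h₂, smul_zero, Pi.add_apply] at hsum
    linarith [hy.2.1 a ha, hz.2.1 a ha]
  by_cases heT : e ∈ T
  · exact hy.2.2 e heT
  · by_cases heO : e ∈ O
    · exact main e heO he he'
    · have hinv : Γ.inv e ∈ O := by
        by_contra hc
        exact heO ((hO.2 e heT).2 hc)
      have := main _ hinv he' (by rwa [Γ.inv_inv])
      rwa [hy.1.1, neg_eq_zero] at this

end Orientation

end SerreGraph

/-- For `(T,φ) ∈ OP_Γ`, the extremal rays of `σ(T,φ)` are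
exactly the rays `ℝ≥0·[γ]` for `γ ∈ Cir_φ(Γ∖T)`. -/
theorem stmt7 (Γ : SerreGraph) (p : Set Γ.E × Set Γ.E) (hp : p ∈ Γ.OP)
    (x : Γ.E → ℝ) (hx : x ∈ Γ.sigmaCone p.1 p.2) (hx0 : x ≠ 0) :
    (∀ y ∈ Γ.sigmaCone p.1 p.2, ∀ z ∈ Γ.sigmaCone p.1 p.2,
        x = y + z → ∃ a : ℝ, 0 ≤ a ∧ y = a • x) ↔
      ∃ γ ∈ Γ.Cir p.1 p.2, ∃ r : ℝ, 0 < r ∧ x = r • Γ.circChainR γ := by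
  obtain ⟨T, O⟩ := p
  obtain ⟨hT, hO, -⟩ := hp
  dsimp only at *
  constructor
  · intro hext
    obtain ⟨γ, hγ, hpos⟩ := hx.1.exists_isCircuit_pos hx0
    have hγO : ∀ e ∈ γ, e ∈ O := fun e he => hO.mem_of_pos hx (hpos e he)
    have hcir : γ ∈ Γ.Cir T O := ⟨hγ, hγO, fun e he => hO.1 e (hγO e he)⟩
    obtain ⟨e₁, he₁, hmin⟩ := γ.exists_min_image x hγ.1
    have hm : 0 < x e₁ := hpos e₁ he₁
    have hcyc := hγ.isCycle_circChainR
    obtain ⟨a, ha, hax⟩ := hext (x e₁ • Γ.circChainR γ)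
      ⟨hcyc.smul _,
        fun e he => mul_nonneg hm.le (SerreGraph.circChainR_nonneg hO hcir he),
        fun e he => by
          rw [Pi.smul_apply, SerreGraph.circChainR_eq_zero_of_mem hT hcir he, smul_zero]⟩
      (x - x e₁ • Γ.circChainR γ)
      ⟨hx.1.sub_smul hcyc _, fun e he => by
          rw [Pi.sub_apply, Pi.smul_apply, smul_eq_mul, sub_nonneg]
          by_cases h : e ∈ γ
          · rw [SerreGraph.circChainR_of_mem h, mul_one]
            exact hmin e h
          · rw [SerreGraph.circChainR_of_not_mem h fun h' => hO.inv_notMem he (hγO _ h'),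
              mul_zero]
            exact hx.2.1 e he,
        fun e he => by
          rw [Pi.sub_apply, Pi.smul_apply, SerreGraph.circChainR_eq_zero_of_mem hT hcir he,
            smul_zero, hx.2.2 e he, sub_zero]⟩
      (add_sub_cancel _ _).symm
    have ha0 : a ≠ 0 := by
      rintro rfl
      have := congrFun hax e₁
      rw [Pi.smul_apply, SerreGraph.circChainR_of_mem he₁, zero_smul, Pi.zero_apply,
        smul_eq_mul, mul_one] at this
      exact hm.ne' this
    refine ⟨γ, hcir, a⁻¹ * x e₁, mul_pos (inv_pos.2 (ha.lt_of_ne' ha0)) hm, ?_⟩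
    rw [mul_smul, hax, inv_smul_smul₀ ha0]
  · rintro ⟨γ, hγ, r, hr, rfl⟩ y hy z hz h
    obtain ⟨e, he⟩ := hγ.1.1
    refine ⟨y e / r, div_nonneg (hy.2.1 e (hγ.2.1 e he)) hr.le, ?_⟩
    rw [smul_smul, div_mul_cancel₀ _ hr.ne']
    exact hγ.1.eq_smul_circChainR hy.1
      (fun _ => SerreGraph.eq_zero_of_add_eq hO hy hz h) he
end
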